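/- arXiv:2508.11104 — 4 statements merged into one kernel-verified Lean document; each statement's English description precedes it below -/
import Mathlib

section
/- Let k ≥ 2 and d ≥ 2. Consider the set K of elements of Out(H_{k,d}) that are represented by an automorphism f of H_{k,d} such that (i) for each 1 ≤ i ≤ k, f(z_i) is conjugate in H_{k,d} to some z_j, and (ii) there exists h ∈ H_{k,d} with f(x) = h x h⁻¹ for all x ∈ N. Then K is finite. (Equivalently: the restriction map from the subgroup SymOut⁺(H_{k,d}) of Out(H_{k,d}), consisting of classes of automorphisms sending each z_i to a conjugate of some z_j, to the quotient of the relevant outer automorphism group of N by the image of the conjugation action of H_{k,d}, has finite kernel.) -/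
/-- `H_{k,d}`, the free product of `k` copies of the cyclic group `ℤ/dℤ`. -/
abbrev Hkd (k d : ℕ) : Type := Monoid.CoprodI (fun _ : Fin k => Multiplicative (ZMod d))

/-- The generator `z_i` of the `i`-th free factor of `H_{k,d}`. -/
def zgen (k d : ℕ) (i : Fin k) : Hkd k d :=
  Monoid.CoprodI.of (i := i) (Multiplicative.ofAdd (1 : ZMod d))

/-- The homomorphism `H_{k,d} → ℤ/dℤ` sending each `z_i` to `1`. -/
def projH (k d : ℕ) : Hkd k d →* Multiplicative (ZMod d) :=
  Monoid.CoprodI.lift (fun _ => MonoidHom.id (Multiplicative (ZMod d)))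

/-- The subgroup of inner automorphisms of `G`. -/
def Inn (G : Type) [Group G] : Subgroup (MulAut G) := (MulAut.conj (G := G)).range

instance Inn.normal (G : Type) [Group G] : (Inn G).Normal := by
  constructor
  rintro f ⟨h, rfl⟩ g
  refine ⟨g h, ?_⟩
  ext x
  simp [MulAut.mul_apply, MulAut.conj_apply, map_mul, map_inv, MulAut.inv_def,
    MulEquiv.apply_symm_apply, mul_assoc]

/-- The outer automorphism group `Out(G) = Aut(G)/Inn(G)`. -/
abbrev Out (G : Type) [Group G] : Type := MulAut G ⧸ Inn G

open Monoid.CoprodI in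
theorem neword_head_eq {k d : ℕ} {i l a b : Fin k}
    (w : NeWord (fun _ : Fin k => Multiplicative (ZMod d)) i l)
    (n : NeWord (fun _ : Fin k => Multiplicative (ZMod d)) a b)
    (h : w.prod = n.prod) : i = a ∧ w.head = n.head := by
  classical
  have h1 : w.toWord = n.toWord := by
    apply (Word.equiv (M := fun _ : Fin k => Multiplicative (ZMod d))).symm.injective
    exact h
  have h2 : w.toList = n.toList := congrArg Word.toList h1
  have h3 := congrArg List.head? h2
  rw [NeWord.toList_head?, NeWord.toList_head?] at h3
  simp at h3
  exact ⟨h3.1, h3.2⟩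

open Monoid.CoprodI in
theorem neword_comm {k d : ℕ} {i l a b : Fin k}
    (w : NeWord (fun _ : Fin k => Multiplicative (ZMod d)) i l)
    (n : NeWord (fun _ : Fin k => Multiplicative (ZMod d)) a b)
    (hla : l ≠ a) (hbi : b ≠ i)
    (h : w.prod * n.prod = n.prod * w.prod) : i = a ∧ w.head = n.head := by
  have := neword_head_eq (w.append hla n) (n.append hbi w) (by simpa using h)
  simpa using this

theorem projH_of (k d : ℕ) (i : Fin k) (x : Multiplicative (ZMod d)) :
    projH k d (Monoid.CoprodI.of (M := fun _ : Fin k => Multiplicative (ZMod d)) (i := i) x)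
      = x := by
  simp [projH]

open Monoid.CoprodI in
theorem centralizer_trivial (k d : ℕ) (hk : 2 ≤ k) (hd : 2 ≤ d) (hkd : 3 ≤ k ∨ 3 ≤ d)
    (c : Hkd k d) (hc : ∀ x ∈ (projH k d).ker, c * x = x * c) : c = 1 := by
  classical
  by_contra hne
  have : Nontrivial (ZMod d) := by
    have : Fact (1 < d) := ⟨by omega⟩
    infer_instance
  let z : Multiplicative (ZMod d) := Multiplicative.ofAdd 1
  have hz : z ≠ 1 := by
    intro h
    exact one_ne_zero (α := ZMod d) (Multiplicative.ofAdd.injective h)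
  have hz' : z⁻¹ ≠ 1 := by simpa using hz
  obtain ⟨i, l, w, hw⟩ := NeWord.of_word (Word.equiv c) (by
    intro h
    apply hne
    have := congrArg Word.equiv.symm h
    rw [Equiv.symm_apply_apply] at this
    rw [this]
    exact Word.prod_empty)
  have hwc : w.prod = c := by
    have := congrArg Word.equiv.symm hw
    rw [Equiv.symm_apply_apply] at this
    exact this
  have key : ∀ {a b : Fin k} (n : NeWord (fun _ : Fin k => Multiplicative (ZMod d)) a b),
      l ≠ a → b ≠ i → projH k d n.prod = 1 → i = a ∧ w.head = n.head := by
    intro a b n h1 h2 h3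
    exact neword_comm w n h1 h2 (by rw [hwc]; exact hc _ h3)
  rcases hkd with h3 | h3
  · obtain ⟨a, ha⟩ : ∃ a : Fin k, a ∉ ({i, l} : Finset (Fin k)) := by
      by_contra! h
      have h1 := Finset.card_le_card (fun x _ => h x : Finset.univ ⊆ ({i, l} : Finset (Fin k)))
      have h2 := Finset.card_le_two (a := i) (b := l)
      simp only [Finset.card_univ, Fintype.card_fin] at h1
      omega
    obtain ⟨b, hb⟩ : ∃ b : Fin k, b ∉ ({i, a} : Finset (Fin k)) := by
      by_contra! h
      have h1 := Finset.card_le_card (fun x _ => h x : Finset.univ ⊆ ({i, a} : Finset (Fin k)))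
      have h2 := Finset.card_le_two (a := i) (b := a)
      simp only [Finset.card_univ, Fintype.card_fin] at h1
      omega
    simp only [Finset.mem_insert, Finset.mem_singleton, not_or] at ha hb
    have := key ((NeWord.singleton (i := a) z hz).append (Ne.symm hb.2) (NeWord.singleton z⁻¹ hz'))
      (Ne.symm ha.2) hb.1 (by simp [projH_of, -map_inv])
    exact ha.1 this.1.symm
  · have hzz : z ≠ z⁻¹ := by
      intro h
      have h1 : (1 : ZMod d) = -1 := Multiplicative.ofAdd.injective h
      have : Fact (2 < d) := ⟨by omega⟩
      exact ZMod.neg_one_ne_one h1.symm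
    by_cases hil : i = l
    · obtain ⟨a, ha⟩ : ∃ a : Fin k, a ≠ i := by
        have : Nontrivial (Fin k) := Fin.nontrivial_iff_two_le.2 hk
        exact exists_ne i
      have hz2 : z⁻¹ * z⁻¹ ≠ 1 := by
        intro h
        apply hzz
        have h5 := eq_inv_of_mul_eq_one_left h
        rw [inv_inv] at h5
        exact h5.symm
      have := key (((NeWord.singleton (i := a) z hz).append ha (NeWord.singleton (i := i) z hz)).append
        (Ne.symm ha) (NeWord.singleton (z⁻¹ * z⁻¹) hz2))
        (by rw [← hil]; exact ha.symm) ha (by simp [projH_of, -map_inv, -map_mul, map_mul (projH k d)])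
      exact ha this.1.symm
    · have h1 := key ((NeWord.singleton (i := i) z hz).append hil (NeWord.singleton z⁻¹ hz'))
        (Ne.symm hil) (Ne.symm hil) (by simp [projH_of, -map_inv])
      have h2 := key ((NeWord.singleton (i := i) z⁻¹ hz').append hil (NeWord.singleton z hz))
        (Ne.symm hil) (Ne.symm hil) (by simp [projH_of, -map_inv])
      exact hzz (by simpa using h1.2.symm.trans h2.2)

theorem aut_ext (k d : ℕ) (f g : MulAut (Hkd k d))
    (h : ∀ i, f (zgen k d i) = g (zgen k d i)) : f = g := by
  have : f.toMonoidHom = g.toMonoidHom := by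
    apply Monoid.CoprodI.ext_hom
    intro i
    refine MonoidHom.ext fun x => ?_
    obtain ⟨n, hn⟩ := ZMod.intCast_surjective (Multiplicative.toAdd x)
    have hx : x = (Multiplicative.ofAdd (1 : ZMod d)) ^ n := by
      apply Multiplicative.toAdd.injective
      rw [← hn]; simp
    have := h i
    unfold zgen at this
    subst hx
    simp only [MonoidHom.comp_apply, map_zpow]
    exact congrArg (· ^ n) this
  ext x
  exact DFunLike.congr_fun this x

theorem zgen_sq (i : Fin 2) : zgen 2 2 i * zgen 2 2 i = 1 := by
  unfold zgen
  rw [← map_mul]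
  have : (Multiplicative.ofAdd (1 : ZMod 2)) * Multiplicative.ofAdd 1 = 1 := by decide
  rw [this, map_one]

theorem dihedral_conj (h : Hkd 2 2) :
    h * (zgen 2 2 0 * zgen 2 2 1) * h⁻¹ = zgen 2 2 0 * zgen 2 2 1 ∨
    h * (zgen 2 2 0 * zgen 2 2 1) * h⁻¹ = (zgen 2 2 0 * zgen 2 2 1)⁻¹ := by
  have h0 := zgen_sq 0
  have h1 := zgen_sq 1
  have i0 : (zgen 2 2 0)⁻¹ = zgen 2 2 0 := inv_eq_of_mul_eq_one_left h0
  have i1 : (zgen 2 2 1)⁻¹ = zgen 2 2 1 := inv_eq_of_mul_eq_one_left h1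
  induction h using Monoid.CoprodI.induction_on with
  | one => left; simp
  | of i x =>
    have hx : x = 1 ∨ x = Multiplicative.ofAdd (1 : ZMod 2) := by
      revert x; decide
    rcases hx with rfl | rfl
    · left; simp
    · right
      change zgen 2 2 i * _ * (zgen 2 2 i)⁻¹ = _
      fin_cases i
      · simp only [Fin.zero_eta, mul_inv_rev, i0, i1]
        rw [← mul_assoc, h0, one_mul]
      · simp only [Fin.mk_one, mul_inv_rev, i0, i1]
        rw [mul_assoc, mul_assoc, h1, mul_one]
  | mul x y hx hy =>
    have e : x * y * (zgen 2 2 0 * zgen 2 2 1) * (x * y)⁻¹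
      = x * (y * (zgen 2 2 0 * zgen 2 2 1) * y⁻¹) * x⁻¹ := by group
    rw [e]
    rcases hy with hy | hy
    · rw [hy]; exact hx
    · rw [hy]
      have e2 : x * (zgen 2 2 0 * zgen 2 2 1)⁻¹ * x⁻¹
        = (x * (zgen 2 2 0 * zgen 2 2 1) * x⁻¹)⁻¹ := by group
      rw [e2]
      rcases hx with hx | hx
      · right; rw [hx]
      · left; rw [hx, inv_inv]

theorem stmt3 (k d : ℕ) (hk : 2 ≤ k) (hd : 2 ≤ d) :
    Set.Finite {c : Out (Hkd k d) | ∃ f : MulAut (Hkd k d),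
      QuotientGroup.mk' (Inn (Hkd k d)) f = c ∧
      (∀ i : Fin k, ∃ j : Fin k, IsConj (zgen k d j) (f (zgen k d i))) ∧
      (∃ h : Hkd k d, ∀ x ∈ (projH k d).ker, f x = h * x * h⁻¹)} := by
  by_cases hkd : 3 ≤ k ∨ 3 ≤ d
  · refine (Set.finite_singleton (1 : Out (Hkd k d))).subset ?_
    rintro c ⟨f, rfl, -, h, hh⟩
    rw [Set.mem_singleton_iff, QuotientGroup.mk'_apply, QuotientGroup.eq_one_iff]
    refine ⟨h, ?_⟩
    ext y
    rw [MulAut.conj_apply]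
    have := centralizer_trivial k d hk hd hkd (y⁻¹ * h⁻¹ * f y * h) (by
      intro x hx
      have h1 := hh (y * x * y⁻¹) ((projH k d).normal_ker.conj_mem x hx y)
      rw [map_mul, map_mul, map_inv, hh x hx] at h1
      have h2 : y⁻¹ * h⁻¹ * (f y * (h * x * h⁻¹) * (f y)⁻¹) * f y * h
        = y⁻¹ * h⁻¹ * f y * h * x := by group
      rw [← h2, h1]
      group)
    have h3 : f y = h * y * (y⁻¹ * h⁻¹ * f y * h) * h⁻¹ := by group
    rw [h3, this, mul_one]
  · obtain rfl : k = 2 := by omega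
    obtain rfl : d = 2 := by omega
    let t := zgen 2 2 0 * zgen 2 2 1
    let S : Set (MulAut (Hkd 2 2)) :=
      {f | f (zgen 2 2 0) ∈ Set.range (zgen 2 2) ∧ f t ∈ ({t, t⁻¹} : Set (Hkd 2 2))}
    have hS : S.Finite := by
      refine Set.Finite.of_injOn (f := fun f => (f (zgen 2 2 0), f t))
        (t := Set.range (zgen 2 2) ×ˢ ({t, t⁻¹} : Set (Hkd 2 2))) ?_ ?_
        ((Set.finite_range _).prod (Set.toFinite _))
      · intro f hf
        exact ⟨hf.1, hf.2⟩
      · intro f _ g _ hfg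
        simp only [Prod.mk.injEq, t, map_mul] at hfg
        apply aut_ext
        intro i
        fin_cases i
        · exact hfg.1
        · have := hfg.2
          rw [hfg.1] at this
          exact mul_left_cancel this
    refine (hS.image (QuotientGroup.mk' (Inn (Hkd 2 2)))).subset ?_
    rintro c ⟨f, rfl, hf, h, hh⟩
    obtain ⟨j, hj⟩ := hf 0
    obtain ⟨w, hw⟩ := isConj_iff.1 hj
    refine ⟨MulAut.conj w⁻¹ * f, ⟨⟨j, ?_⟩, ?_⟩, ?_⟩
    · rw [MulAut.mul_apply, MulAut.conj_apply, ← hw]; group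
    · have ht : t ∈ (projH 2 2).ker := by
        rw [MonoidHom.mem_ker]
        simp only [t, zgen, map_mul, projH_of]
        decide
      rw [MulAut.mul_apply, MulAut.conj_apply, hh t ht]
      have := dihedral_conj (w⁻¹ * h)
      have e : w⁻¹ * (h * t * h⁻¹) * w⁻¹⁻¹ = (w⁻¹ * h) * t * (w⁻¹ * h)⁻¹ := by group
      rw [e]
      exact this
    · rw [map_mul]
      have : QuotientGroup.mk' (Inn (Hkd 2 2)) (MulAut.conj w⁻¹) = 1 := by
        rw [QuotientGroup.mk'_apply, QuotientGroup.eq_one_iff]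
        exact ⟨w⁻¹, rfl⟩
      rw [this, one_mul]
end

section
/- Let k ≥ 2 and d ≥ 2, and let f be an automorphism of H_{k,d} such that for each 1 ≤ j ≤ k the element f(z_j) is conjugate in H_{k,d} to z_j, such that f(x) = x for all x ∈ N, and such that f(z_i) = z_i for at least one index i. Then f is the identity automorphism of H_{k,d}. -/
/-- **Statement 5.** Let `k ≥ 2`, `d ≥ 2`, and let `f` be an automorphism of `H_{k,d}`
such that each `f(z_j)` is conjugate in `H_{k,d}` to `z_j`, such that `f` fixes pointwise
the kernel `N` of the map `H_{k,d} → ℤ/dℤ` sending each `z_i` to `1`, and such that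
`f(z_i) = z_i` for at least one index `i`.  Then `f` is the identity automorphism. -/
theorem stmt5 (k d : ℕ) (hk : 2 ≤ k) (hd : 2 ≤ d)
    (f : MulAut (Hkd k d))
    (hconj : ∀ j : Fin k, IsConj (zgen k d j) (f (zgen k d j)))
    (hN : ∀ x ∈ (projH k d).ker, f x = x)
    (hfix : ∃ i : Fin k, f (zgen k d i) = zgen k d i) :
    f = MulEquiv.refl (Hkd k d) := by
  obtain ⟨i, hi⟩ := hfix
  haveI : NeZero d := ⟨by omega⟩
  ext x
  have hz : projH k d (zgen k d i) = Multiplicative.ofAdd (1 : ZMod d) := by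
    simp [projH, zgen]
  -- write `x = (x * z_i ^ (-m)) * z_i ^ m` with the first factor in the kernel
  obtain ⟨m, hm⟩ : ∃ m : ℕ, projH k d x = projH k d (zgen k d i) ^ m := by
    refine ⟨(Multiplicative.toAdd (projH k d x)).val, ?_⟩
    rw [hz, ← ofAdd_nsmul, nsmul_one, ZMod.natCast_zmod_val, ofAdd_toAdd]
  have hx : x * (zgen k d i ^ m)⁻¹ ∈ (projH k d).ker := by
    rw [MonoidHom.mem_ker, map_mul, map_inv, map_pow, hm, mul_inv_cancel]
  have h := hN _ hx
  rw [map_mul, map_inv, map_pow, hi] at h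
  exact mul_right_cancel h
end

section
/- Let A and B be groups, let a ∈ A with a ≠ 1 and b ∈ B with b ≠ 1, and set c = b a b⁻¹, viewed as elements of the free product A * B. Then a and c generate their free product in A * B: the homomorphism from the free product ⟨a⟩ * ⟨c⟩ of the cyclic subgroup generated by a and the cyclic subgroup generated by c to A * B induced by the two inclusion maps is injective. -/
open Monoid

/-- Multiplying a reduced word by a nontrivial letter of a different factor prepends it. -/
theorem aux_fstIdx_smul {ι : Type*} [DecidableEq ι] {M : ι → Type*} [∀ i, Group (M i)]
    [∀ i, DecidableEq (M i)] {i : ι} (m : M i) (hm : m ≠ 1) (w : CoprodI.Word M)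
    (hw : w.fstIdx ≠ some i) :
    ((CoprodI.of m : CoprodI M) • w).fstIdx = some i := by
  rw [← CoprodI.Word.cons_eq_smul (h1 := hw) (h2 := hm)]
  exact CoprodI.Word.fstIdx_cons _ _ _ _

/-- The two factors as a family of subgroups. -/
def auxT (A B : Type*) [Group A] [Group B] : Bool → Subgroup (Coprod A B)
  | true => (Coprod.inl : A →* Coprod A B).range
  | false => (Coprod.inr : B →* Coprod A B).range

/-- The inclusion of the first factor. -/
def auxL (A B : Type*) [Group A] [Group B] : A →* auxT A B true :=
  (Coprod.inl : A →* Coprod A B).rangeRestrict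

/-- The inclusion of the second factor. -/
def auxR (A B : Type*) [Group A] [Group B] : B →* auxT A B false :=
  (Coprod.inr : B →* Coprod A B).rangeRestrict

/-- Comparison with the indexed free product. -/
noncomputable def auxPhi (A B : Type*) [Group A] [Group B] :
    Coprod A B →* CoprodI (fun i => auxT A B i) :=
  Coprod.lift ((CoprodI.of (M := fun i => auxT A B i) (i := true)).comp (auxL A B))
    ((CoprodI.of (M := fun i => auxT A B i) (i := false)).comp (auxR A B))

theorem auxL_ne {A B : Type*} [Group A] [Group B] {a : A} (h : a ≠ 1) : auxL A B a ≠ 1 := by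
  intro h'
  have h2 : (Coprod.inl a : Coprod A B) = 1 := congrArg Subtype.val h'
  exact h (Coprod.inl_injective (h2.trans (map_one _).symm))

theorem auxR_ne {A B : Type*} [Group A] [Group B] {a : B} (h : a ≠ 1) : auxR A B a ≠ 1 := by
  intro h'
  have h2 : (Coprod.inr a : Coprod A B) = 1 := congrArg Subtype.val h'
  exact h (Coprod.inr_injective (h2.trans (map_one _).symm))

/-- The two cyclic subgroups together with the trivial one. -/
def auxS {G : Type*} [Group G] (x y : G) : Option Bool → Subgroup G
  | none => ⊥
  | some true => Subgroup.zpowers x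
  | some false => Subgroup.zpowers y

theorem aux_inj {A B : Type*} [Group A] [Group B]
    (a : A) (ha : a ≠ 1) (b : B) (hb : b ≠ 1) :
    Function.Injective (CoprodI.lift (M := fun i => auxS (Coprod.inl a : Coprod A B)
      (Coprod.inr b * Coprod.inl a * (Coprod.inr b)⁻¹) i)
      (fun i => (auxPhi A B).comp (auxS (Coprod.inl a : Coprod A B)
      (Coprod.inr b * Coprod.inl a * (Coprod.inr b)⁻¹) i).subtype)) := by
  classical
  refine CoprodI.lift_injective_of_ping_pong _ (Or.inl ?_)
    (fun i : Option Bool => {w : CoprodI.Word (fun i => auxT A B i) | w.fstIdx = i}) ?_ ?_ ?_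
  · simp
  · rintro (_ | _ | _)
    · exact ⟨CoprodI.Word.empty, rfl⟩
    · exact ⟨_, aux_fstIdx_smul (M := fun i => auxT A B i) (auxR A B b) (auxR_ne hb)
        CoprodI.Word.empty (by simp [CoprodI.Word.fstIdx, CoprodI.Word.empty])⟩
    · exact ⟨_, aux_fstIdx_smul (M := fun i => auxT A B i) (auxL A B a) (auxL_ne ha)
        CoprodI.Word.empty (by simp [CoprodI.Word.fstIdx, CoprodI.Word.empty])⟩
  · intro i j hij
    rw [Function.onFun, Set.disjoint_left]
    intro w h1 h2
    exact hij (h1.symm.trans h2)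
  · rintro (_ | _ | _) j hij ⟨h, hh⟩ hne
    · exact absurd (Subtype.ext (Subgroup.mem_bot.1 hh)) hne
    · obtain ⟨k, rfl⟩ := Subgroup.mem_zpowers_iff.1 hh
      have hk : a ^ k ≠ 1 := by
        intro h
        apply hne
        apply Subtype.ext
        simp [conj_zpow, ← map_zpow, h]
      rintro _ ⟨w, hw, rfl⟩
      have hw' : w.fstIdx ≠ some false := fun h => hij (h.symm.trans hw)
      have e : auxPhi A B ((Coprod.inr b * Coprod.inl a * (Coprod.inr b)⁻¹) ^ k)
          = CoprodI.of (M := fun i => auxT A B i) (auxR A B b) *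
            (CoprodI.of (M := fun i => auxT A B i) (auxL A B (a ^ k)) *
            CoprodI.of (M := fun i => auxT A B i) (auxR A B b⁻¹)) := by
        rw [conj_zpow, ← map_zpow]
        simp only [auxPhi, map_mul, map_inv, Coprod.lift_apply_inl, Coprod.lift_apply_inr,
          MonoidHom.comp_apply, mul_assoc]
      change (auxPhi A B ((Coprod.inr b * Coprod.inl a * (Coprod.inr b)⁻¹) ^ k) • w).fstIdx
        = some false
      rw [e, mul_smul, mul_smul]
      refine aux_fstIdx_smul _ (auxR_ne hb) _ ?_
      rw [aux_fstIdx_smul _ (auxL_ne hk)]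
      · simp
      · rw [aux_fstIdx_smul _ (auxR_ne (inv_ne_one.2 hb)) _ hw']
        simp
    · obtain ⟨k, rfl⟩ := Subgroup.mem_zpowers_iff.1 hh
      have hk : a ^ k ≠ 1 := by
        intro h
        apply hne
        apply Subtype.ext
        simp [← map_zpow, h]
      rintro _ ⟨w, hw, rfl⟩
      have hw' : w.fstIdx ≠ some true := fun h => hij (h.symm.trans hw)
      have e : auxPhi A B ((Coprod.inl a) ^ k)
          = CoprodI.of (M := fun i => auxT A B i) (auxL A B (a ^ k)) := by
        simp [← map_zpow, auxPhi]
      change (auxPhi A B ((Coprod.inl a) ^ k) • w).fstIdx = some true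
      rw [e]
      exact aux_fstIdx_smul _ (auxL_ne hk) _ hw'

theorem aux_coprod {G K : Type*} [Group G] [Group K] (x y : G) (φ : G →* K)
    (h : Function.Injective (CoprodI.lift (M := fun i => auxS x y i)
      (fun i => φ.comp (auxS x y i).subtype))) :
    Function.Injective (Coprod.lift (Subgroup.zpowers x).subtype
      (Subgroup.zpowers y).subtype) := by
  let ψ : Coprod (Subgroup.zpowers x) (Subgroup.zpowers y) →* CoprodI (fun i => auxS x y i) :=
    Coprod.lift (CoprodI.of (M := fun i => auxS x y i) (i := some true))
      (CoprodI.of (M := fun i => auxS x y i) (i := some false))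
  let θ : CoprodI (fun i => auxS x y i) →* Coprod (Subgroup.zpowers x) (Subgroup.zpowers y) :=
    CoprodI.lift (fun i => match i with
      | none => 1
      | some true => Coprod.inl
      | some false => Coprod.inr)
  have hθ : θ.comp ψ = MonoidHom.id _ := by
    apply Coprod.hom_ext
    · ext1 z
      simp only [MonoidHom.comp_apply, ψ, Coprod.lift_apply_inl]
      exact CoprodI.lift_of _ _
    · ext1 z
      simp only [MonoidHom.comp_apply, ψ, Coprod.lift_apply_inr]
      exact CoprodI.lift_of _ _
  have hψ : Function.Injective ψ :=
    Function.LeftInverse.injective (g := θ) (fun z => DFunLike.congr_fun hθ z)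
  have hc : (CoprodI.lift (M := fun i => auxS x y i)
      (fun i => φ.comp (auxS x y i).subtype)).comp ψ =
      φ.comp (Coprod.lift (Subgroup.zpowers x).subtype (Subgroup.zpowers y).subtype) := by
    apply Coprod.hom_ext
    · ext1 z
      simp only [MonoidHom.comp_apply, ψ, Coprod.lift_apply_inl]
      exact CoprodI.lift_of _ _
    · ext1 z
      simp only [MonoidHom.comp_apply, ψ, Coprod.lift_apply_inr]
      exact CoprodI.lift_of _ _
  have h2 := h.comp hψ
  rw [← MonoidHom.coe_comp, hc, MonoidHom.coe_comp] at h2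
  exact h2.of_comp


/-- **Statement 9.** Let `A`, `B` be groups, `a ∈ A` and `b ∈ B` nontrivial, and let
`c = b * a * b⁻¹` in the free product `A ∗ B`.  Then the natural homomorphism from the
free product `⟨a⟩ ∗ ⟨c⟩` of the cyclic subgroups generated by `a` and `c` to `A ∗ B`,
induced by the two inclusions, is injective. -/
theorem stmt9 {A B : Type*} [Group A] [Group B]
    (a : A) (ha : a ≠ 1) (b : B) (hb : b ≠ 1) :
    Function.Injective
      (Monoid.Coprod.lift
        (Subgroup.zpowers (Monoid.Coprod.inl a : Monoid.Coprod A B)).subtype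
        (Subgroup.zpowers ((Monoid.Coprod.inr b : Monoid.Coprod A B) * Monoid.Coprod.inl a *
          (Monoid.Coprod.inr b : Monoid.Coprod A B)⁻¹)).subtype) := by
  exact aux_coprod _ _ _ (aux_inj a ha b hb)
end

section
/- Let A, B, C, D be groups and let Ψ : A → B, Φ : A → C, F : B → D, P : C → D be group homomorphisms satisfying F ∘ Ψ = P ∘ Φ. Suppose that Ψ is surjective, that Φ is injective, and that the image of Φ has finite index in C. If the kernel of F is not finitely generated, then the kernel of P is not finitely generated. -/
/-- **Statement 11.** Let `Ψ : A → B`, `Φ : A → C`, `F : B → D`, `P : C → D` be group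
homomorphisms with `F ∘ Ψ = P ∘ Φ`, `Ψ` surjective, `Φ` injective with finite-index image.
If `ker F` is not finitely generated, then `ker P` is not finitely generated. -/
theorem stmt11 {A B C D : Type*} [Group A] [Group B] [Group C] [Group D]
    (Ψ : A →* B) (Φ : A →* C) (F : B →* D) (P : C →* D)
    (hcomm : F.comp Ψ = P.comp Φ)
    (hΨ : Function.Surjective Ψ)
    (hΦ : Function.Injective Φ)
    (hindex : Φ.range.FiniteIndex)
    (hF : ¬ (F.ker).FG) :
    ¬ (P.ker).FG := by
  intro hP
  apply hF
  have : Group.FG P.ker := (Group.fg_iff_subgroup_fg _).2 hP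
  -- Schreier lemma: the finite-index subgroup of `ker P` is finitely generated
  have hK : Group.FG (Φ.range.subgroupOf P.ker) := inferInstance
  let e : A ≃* Φ.range := MonoidHom.ofInjective hΦ
  let i : Φ.range.subgroupOf P.ker →* Φ.range :=
    (P.ker.subtype.comp (Φ.range.subgroupOf P.ker).subtype).codRestrict Φ.range
      (fun x => x.2)
  let h : Φ.range.subgroupOf P.ker →* B := Ψ.comp (e.symm.toMonoidHom.comp i)
  have hc : ∀ a, F (Ψ a) = P (Φ a) := fun a => DFunLike.congr_fun hcomm a
  have hr : h.range = F.ker := by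
    ext b
    constructor
    · rintro ⟨x, rfl⟩
      have h1 : Φ (e.symm (i x)) = ((x : P.ker) : C) :=
        congrArg Subtype.val (e.apply_symm_apply (i x))
      change F (Ψ (e.symm (i x))) = 1
      rw [hc, h1]
      exact x.1.2
    · intro hb
      obtain ⟨a, rfl⟩ := hΨ b
      have ha : P (Φ a) = 1 := by rw [← hc]; exact hb
      refine ⟨⟨⟨Φ a, ha⟩, ⟨a, rfl⟩⟩, ?_⟩
      change Ψ (e.symm (e a)) = Ψ a
      rw [e.symm_apply_apply]
  rw [← hr]
  exact (Group.fg_iff_subgroup_fg _).1 (Group.fg_range h)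
end
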